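/- For every σ = (σ_1,…,σ_{n+1}) ∈ Γ_A (the polynomial version of the affine A orbit set), there exist natural numbers N_{ij} (i, j ∈ I) such that σ_i = 2∑_{j∈I} N_{ij} X_j for every i ∈ I. -/

import Mathlib

open Finset

/-- The generalized Cartan matrix of type `A_n^{(1)}`, with indices read cyclically
(`K i i = 2`, `K i j = -1` when `i,j` are cyclically adjacent, `0` otherwise). -/
noncomputable def affA (n : ℕ) (i j : ZMod (n + 1)) : ℝ :=
  if i = j then 2 else if i = j + 1 ∨ j = i + 1 then -1 else 0

/-- The polynomial affine reflection `ℜ_i` on `R^{n+1}`, `R = ℝ[X_1,…,X_{n+1}]`: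
`(ℜ_i σ)_i = 2 X_i - ∑_t K_{i t} σ_t + σ_i` and `(ℜ_i σ)_j = σ_j` for `j ≠ i`. -/
noncomputable def reflAP (n : ℕ) (i : ZMod (n + 1))
    (σ : ZMod (n + 1) → MvPolynomial (ZMod (n + 1)) ℝ) :
    ZMod (n + 1) → MvPolynomial (ZMod (n + 1)) ℝ :=
  Function.update σ i
    (2 * MvPolynomial.X i
      - ∑ t : ZMod (n + 1), MvPolynomial.C (affA n i t) * σ t + σ i)

/-- `Γ_A` (polynomial version): the smallest subset of `R^{n+1}` containing `0`
and closed under all `ℜ_i`. -/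
inductive GammaAP (n : ℕ) : (ZMod (n + 1) → MvPolynomial (ZMod (n + 1)) ℝ) → Prop
  | zero : GammaAP n 0
  | refl (i : ZMod (n + 1)) (σ : ZMod (n + 1) → MvPolynomial (ZMod (n + 1)) ℝ) :
      GammaAP n σ → GammaAP n (reflAP n i σ)

/-- On a cycle, twice the difference of two values is at most the total variation. -/
theorem two_mul_sub_le_sum_abs_sub_add_one {n : ℕ} (v : ZMod (n + 1) → ℤ) (j k : ZMod (n + 1)) :
    2 * (v j - v k) ≤ ∑ t, |v t - v (t + 1)| := by
  set w : ℕ → ℤ := fun m => v (j + m) with hw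
  have hsum : ∑ t, |v t - v (t + 1)| = ∑ m ∈ range (n + 1), |w m - w (m + 1)| := by
    refine Finset.sum_bij' (fun t _ => (t - j).val) (fun m _ => j + m) ?_ ?_ ?_ ?_ ?_
    · intro t _
      exact mem_range.2 (ZMod.val_lt _)
    · intro m _
      exact mem_univ _
    · intro t _
      simp
    · intro m hm
      simp [ZMod.val_natCast_of_lt (mem_range.1 hm)]
    · intro t _
      have h : t + 1 = j + (t - j + 1) := by ring
      simp [hw, ← h]
  have hm : (k - j).val ≤ n + 1 := (ZMod.val_lt _).le
  have telescope : ∀ a b : ℕ, a ≤ b → |w a - w b| ≤ ∑ m ∈ Ico a b, |w m - w (m + 1)| := by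
    intro a b hab
    induction b, hab using Nat.le_induction with
    | base => simp
    | succ b hab ih =>
      rw [Finset.sum_Ico_succ_top hab]
      exact (abs_sub_le _ (w b) _).trans (by linarith)
  have h0 : w 0 = v j := by simp [hw]
  have h1 : w (k - j).val = v k := by simp [hw]
  have h2 : w (n + 1) = v j := by
    have : ((n + 1 : ℕ) : ZMod (n + 1)) = 0 := ZMod.natCast_self _
    simp only [hw, this, add_zero]
  have ha := telescope 0 _ (Nat.zero_le (k - j).val)
  have hb := telescope _ _ hm
  rw [hsum, range_eq_Ico, ← Finset.sum_Ico_consecutive _ (Nat.zero_le _) hm]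
  rw [h0, h1] at ha
  rw [h1, h2] at hb
  have := le_abs_self (v j - v k)
  have := neg_abs_le (v k - v j)
  linarith

/-- An integer function on a cycle whose Dirichlet energy is twice its value at some point is
nonnegative. -/
theorem nonneg_of_sum_sq_sub_add_one_eq {n : ℕ} (v : ZMod (n + 1) → ℤ) (j : ZMod (n + 1))
    (h : ∑ t, (v t - v (t + 1)) ^ 2 = 2 * v j) (k : ZMod (n + 1)) : 0 ≤ v k := by
  have h1 := two_mul_sub_le_sum_abs_sub_add_one v j k
  have h2 : ∑ t, |v t - v (t + 1)| ≤ ∑ t, (v t - v (t + 1)) ^ 2 := by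
    refine Finset.sum_le_sum fun t _ => ?_
    rw [← sq_abs]
    exact Int.le_self_sq _
  linarith

theorem ZMod.one_ne_zero_of_two_le {n : ℕ} (hn : 2 ≤ n) : (1 : ZMod (n + 1)) ≠ 0 := by
  have : Fact (1 < n + 1) := ⟨by omega⟩
  exact one_ne_zero

theorem ZMod.two_ne_zero_of_two_le {n : ℕ} (hn : 2 ≤ n) : (1 + 1 : ZMod (n + 1)) ≠ 0 := by
  intro h
  have h2 : ((2 : ℕ) : ZMod (n + 1)) = 0 := by
    rw [← h]
    norm_num
  rw [ZMod.natCast_eq_zero_iff] at h2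
  have := Nat.le_of_dvd (by norm_num) h2
  omega

/-- The effect on the Dirichlet energy of changing one value. -/
theorem sum_sq_sub_add_one_update {n : ℕ} (hn : 2 ≤ n) (v : ZMod (n + 1) → ℤ)
    (i : ZMod (n + 1)) (x : ℤ) :
    ∑ t, (Function.update v i x t - Function.update v i x (t + 1)) ^ 2 =
      ∑ t, (v t - v (t + 1)) ^ 2 +
        2 * (x - v i) * (x + v i - v (i - 1) - v (i + 1)) := by
  have h1 := ZMod.one_ne_zero_of_two_le hn
  have key : ∀ t, (Function.update v i x t - Function.update v i x (t + 1)) ^ 2 =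
      (v t - v (t + 1)) ^ 2
        + (if t = i then (x - v (i + 1)) ^ 2 - (v i - v (i + 1)) ^ 2 else 0)
        + (if t = i - 1 then (v (i - 1) - x) ^ 2 - (v (i - 1) - v i) ^ 2 else 0) := by
    intro t
    by_cases ht : t = i
    · subst ht
      have : t ≠ t - 1 := by simpa [eq_sub_iff_add_eq] using h1
      simp [this, h1]
    · by_cases ht' : t = i - 1
      · subst ht'
        simp [h1]
      · have : t + 1 ≠ i := fun h => ht' (eq_sub_of_add_eq h)
        simp [ht, ht', this]
  simp_rw [key, Finset.sum_add_distrib]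
  simp only [Finset.sum_ite_eq', mem_univ, if_true]
  ring

theorem sum_affA_mul {n : ℕ} (hn : 2 ≤ n) (i : ZMod (n + 1))
    (σ : ZMod (n + 1) → MvPolynomial (ZMod (n + 1)) ℝ) :
    ∑ t, MvPolynomial.C (affA n i t) * σ t = 2 * σ i - σ (i - 1) - σ (i + 1) := by
  have h1 := ZMod.one_ne_zero_of_two_le hn
  have h2 := ZMod.two_ne_zero_of_two_le hn
  have key : ∀ t, MvPolynomial.C (affA n i t) * σ t =
      (if t = i then 2 * σ i else 0) - (if t = i - 1 then σ (i - 1) else 0)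
        - (if t = i + 1 then σ (i + 1) else 0) := by
    intro t
    unfold affA
    by_cases ht : t = i
    · subst ht
      have : t ≠ t - 1 := by simpa [eq_sub_iff_add_eq] using h1
      have hC : (MvPolynomial.C 2 : MvPolynomial (ZMod (n + 1)) ℝ) = 2 := map_ofNat _ 2
      simp [this, h1, hC]
    · by_cases ht' : t = i - 1
      · subst ht'
        have : i - 1 ≠ i + 1 := by
          intro h
          apply h2
          linear_combination -h
        simp [this, h1, Ne.symm ht]
      · have h3 : i ≠ t + 1 := fun h => ht' (eq_sub_of_add_eq h.symm)
        by_cases ht'' : t = i + 1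
        · subst ht''
          have : i + 1 ≠ i - 1 := ht'
          simp [this, h1]
        · simp [ht, ht', ht'', h3, Ne.symm ht]
  simp_rw [key, Finset.sum_sub_distrib]
  simp

theorem GammaAP.exists_int_coeffs {n : ℕ} (hn : 2 ≤ n)
    {σ : ZMod (n + 1) → MvPolynomial (ZMod (n + 1)) ℝ} (hσ : GammaAP n σ) :
    ∃ N : ZMod (n + 1) → ZMod (n + 1) → ℤ,
      (∀ j, ∑ t, (N j t - N j (t + 1)) ^ 2 = 2 * N j j) ∧
      ∀ i, σ i = 2 * ∑ j, ((N j i : MvPolynomial (ZMod (n + 1)) ℝ) * MvPolynomial.X j) := by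
  induction hσ with
  | zero => exact ⟨0, by simp, by simp⟩
  | refl i σ _ ih =>
    obtain ⟨N, hN, hσN⟩ := ih
    refine ⟨fun j => Function.update (N j) i
      ((if j = i then 1 else 0) - N j i + N j (i - 1) + N j (i + 1)), ?_, ?_⟩
    · intro j
      rw [sum_sq_sub_add_one_update hn, hN]
      by_cases hj : j = i
      · subst hj
        simp only [if_true, Function.update_self]
        ring
      · simp only [hj, if_false, ne_eq, not_false_eq_true, Function.update_of_ne]
        ring
    · intro k
      by_cases hk : k = i
      · subst hk
        simp only [reflAP, Function.update_self, sum_affA_mul hn, hσN]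
        push_cast
        simp only [add_mul, sub_mul, Finset.sum_add_distrib, Finset.sum_sub_distrib, ite_mul,
          one_mul, zero_mul, Finset.sum_ite_eq', mem_univ, if_true]
        ring
      · simp only [reflAP, ne_eq, hk, not_false_eq_true, Function.update_of_ne, hσN]

/-- Every `σ ∈ Γ_A` has components `σ_i = 2 ∑_{j∈I} N_{ij} X_j` with `N_{ij} ∈ ℕ`. -/
theorem gammaAP_nonneg_integer_coeffs (n : ℕ) (hn : 2 ≤ n)
    (σ : ZMod (n + 1) → MvPolynomial (ZMod (n + 1)) ℝ) (hσ : GammaAP n σ) :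
    ∃ N : ZMod (n + 1) → ZMod (n + 1) → ℕ, ∀ i : ZMod (n + 1),
      σ i = 2 * ∑ j : ZMod (n + 1),
        ((N i j : MvPolynomial (ZMod (n + 1)) ℝ) * MvPolynomial.X j) := by
  obtain ⟨N, hN, hσN⟩ := hσ.exists_int_coeffs hn
  refine ⟨fun i j => (N j i).toNat, fun i => ?_⟩
  rw [hσN]
  congr 1
  refine Finset.sum_congr rfl fun j _ => ?_
  have h := Int.toNat_of_nonneg (nonneg_of_sum_sq_sub_add_one_eq (N j) j (hN j) i)
  rw [← Int.cast_natCast (N j i).toNat, h]
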